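/- Assume |Res F| = 1, i.e. there exist A₁,…,A_d ∈ ℂ² ∖ {(0,0)} with F₀(Z) = ∏_{i=1}^d (Z ∧ A_i) for all Z ∈ ℂ² and ∏_{i=1}^d |F₁(A_i)| = 1. Then, in the setting of the dynatomic data below: ∏_{1 ≤ i, j ≤ d_n, i ≠ j} |Z^{(n)}_i ∧ Z^{(n)}_j| · ∏_{ℓ ∣ n, ℓ < n} ∏_{j=1}^{d_ℓ} |C_{n/ℓ}(λ^{(ℓ)}_j)| = ∏_{j=1}^{d_n} |λ^{(n)}_j − 1|. (The first factor on the left is the absolute value of the homogeneous discriminant Disc(Φ^{**}_{F,n}) of the n-th dynatomic polynomial; this is the first displayed equality of the paper's main Theorem, |D^{**}_n| = |Δ_{n,n}|^n · ∏_{ℓ ∣ n, ℓ < n} |Δ_{n,ℓ}|^{n−ℓ}, in the normalization |Res F| = 1.) -/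

import Mathlib

open Filter Finset MvPolynomial

/-- Evaluation of a bivariate polynomial at a point of `ℂ²`. -/
noncomputable def ev (P : MvPolynomial (Fin 2) ℂ) (Z : ℂ × ℂ) : ℂ :=
  MvPolynomial.eval ![Z.1, Z.2] P

/-- The self-map of `ℂ²` determined by the pair `F = (F₀, F₁)`. -/
noncomputable def Fmap (F₀ F₁ : MvPolynomial (Fin 2) ℂ) (Z : ℂ × ℂ) : ℂ × ℂ :=
  (ev F₀ Z, ev F₁ Z)

/-- The wedge `Z ∧ W = Z₀W₁ − Z₁W₀` on `ℂ²`. -/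
def wedge (Z W : ℂ × ℂ) : ℂ := Z.1 * W.2 - Z.2 * W.1

/-- `d_m := ∑_{k ∣ m} μ(m/k)(d^k + 1)`, the number of periodic points of formally exact
period `m` of a degree-`d` rational map. -/
def dyndeg (d m : ℕ) : ℤ :=
  ∑ k ∈ m.divisors, ArithmeticFunction.moebius (m / k) * ((d : ℤ) ^ k + 1)

/-- The affine coordinate `z^{(m)}_j` of the point `Z^{(m)}_j = u·(1, z^{(m)}_j)`. -/
noncomputable def zc (Zp : ℕ → ℕ → ℂ × ℂ) (m j : ℕ) : ℂ := (Zp m j).2 / (Zp m j).1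

/-- The multiplier `λ^{(m)}_j`: the derivative at `z^{(m)}_j` of the map
`w ↦ F₁^{(m)}(1,w) / F₀^{(m)}(1,w)` induced by the `m`-th iterate of `F`. -/
noncomputable def lam (F₀ F₁ : MvPolynomial (Fin 2) ℂ) (Zp : ℕ → ℕ → ℂ × ℂ) (m j : ℕ) : ℂ :=
  deriv (fun w : ℂ => ((Fmap F₀ F₁)^[m] (1, w)).2 / ((Fmap F₀ F₁)^[m] (1, w)).1) (zc Zp m j)


/-- polynomial functions on `ℂ²` -/
def PolyF (p : ℂ × ℂ → ℂ) : Prop := ∃ P : MvPolynomial (Fin 2) ℂ, p = ev P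

lemma PolyF.const (c : ℂ) : PolyF (fun _ => c) := ⟨MvPolynomial.C c, by ext Z; simp [ev]⟩
lemma PolyF.fst : PolyF (fun Z => Z.1) := ⟨MvPolynomial.X 0, by ext Z; simp [ev]⟩
lemma PolyF.snd : PolyF (fun Z => Z.2) := ⟨MvPolynomial.X 1, by ext Z; simp [ev]⟩
lemma PolyF.add {p q : ℂ × ℂ → ℂ} (hp : PolyF p) (hq : PolyF q) : PolyF (fun Z => p Z + q Z) := by
  obtain ⟨P, rfl⟩ := hp; obtain ⟨Q, rfl⟩ := hq
  exact ⟨P + Q, by ext Z; simp [ev]⟩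
lemma PolyF.sub {p q : ℂ × ℂ → ℂ} (hp : PolyF p) (hq : PolyF q) : PolyF (fun Z => p Z - q Z) := by
  obtain ⟨P, rfl⟩ := hp; obtain ⟨Q, rfl⟩ := hq
  exact ⟨P - Q, by ext Z; simp [ev]⟩
lemma PolyF.mul {p q : ℂ × ℂ → ℂ} (hp : PolyF p) (hq : PolyF q) : PolyF (fun Z => p Z * q Z) := by
  obtain ⟨P, rfl⟩ := hp; obtain ⟨Q, rfl⟩ := hq
  exact ⟨P * Q, by ext Z; simp [ev]⟩
lemma PolyF.pow {p : ℂ × ℂ → ℂ} (hp : PolyF p) (n : ℕ) : PolyF (fun Z => p Z ^ n) := by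
  obtain ⟨P, rfl⟩ := hp
  exact ⟨P ^ n, by ext Z; simp [ev]⟩

lemma ev_ext {P Q : MvPolynomial (Fin 2) ℂ} (h : ∀ Z, ev P Z = ev Q Z) : P = Q := by
  apply MvPolynomial.funext
  intro x
  have := h (x 0, x 1)
  simp only [ev] at this
  have e : ![x 0, x 1] = x := by ext i; fin_cases i <;> rfl
  rwa [e] at this

lemma ev_mul (P Q : MvPolynomial (Fin 2) ℂ) (Z) : ev (P * Q) Z = ev P Z * ev Q Z := by simp [ev]

lemma PolyF.mul_eq_zero {p q : ℂ × ℂ → ℂ} (hp : PolyF p) (hq : PolyF q)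
    (h : ∀ Z, p Z * q Z = 0) : (∀ Z, p Z = 0) ∨ (∀ Z, q Z = 0) := by
  obtain ⟨P, rfl⟩ := hp; obtain ⟨Q, rfl⟩ := hq
  have : P * Q = 0 := ev_ext (fun Z => by rw [ev_mul, h]; simp [ev])
  rcases _root_.mul_eq_zero.1 this with h | h
  · left; intro Z; simp [h, ev]
  · right; intro Z; simp [h, ev]

lemma PolyF.cancel {p q r : ℂ × ℂ → ℂ} (hp : PolyF p) (hq : PolyF q) (hr : PolyF r)
    (hp0 : ∃ Z, p Z ≠ 0) (h : ∀ Z, p Z * q Z = p Z * r Z) : ∀ Z, q Z = r Z := by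
  rcases PolyF.mul_eq_zero hp (hq.sub hr) (fun Z => by rw [mul_sub, h, sub_self]) with h | h
  · obtain ⟨Z, hZ⟩ := hp0; exact absurd (h Z) hZ
  · intro Z; exact sub_eq_zero.1 (h Z)

lemma PolyF.continuous {p : ℂ × ℂ → ℂ} (hp : PolyF p) : Continuous p := by
  obtain ⟨P, rfl⟩ := hp
  unfold ev
  have : Continuous (fun x : Fin 2 → ℂ => MvPolynomial.eval x P) := MvPolynomial.continuous_eval P
  refine this.comp ?_
  refine continuous_pi ?_
  intro i; fin_cases i
  · exact continuous_fst
  · exact continuous_snd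

lemma PolyF.comp {p u v : ℂ × ℂ → ℂ} (hp : PolyF p) (hu : PolyF u) (hv : PolyF v) :
    PolyF (fun Z => p (u Z, v Z)) := by
  obtain ⟨P, rfl⟩ := hp
  induction P using MvPolynomial.induction_on with
  | C a => exact ⟨MvPolynomial.C a, by ext Z; simp [ev]⟩
  | add p q hp hq =>
    have := hp.add hq
    convert this using 2
    simp [ev]
  | mul_X p i hp =>
    fin_cases i
    · have := hp.mul hu
      convert this using 2
      simp [ev]
    · have := hp.mul hv
      convert this using 2
      simp [ev]

/-- divided differences -/
lemma PolyF.div {p u v u' v' M r s : ℂ × ℂ → ℂ} (hp : PolyF p) (hu : PolyF u) (hv : PolyF v)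
    (hu' : PolyF u') (hv' : PolyF v') (hr : PolyF r) (hs : PolyF s)
    (h1 : ∀ Z, u Z = u' Z + M Z * r Z) (h2 : ∀ Z, v Z = v' Z + M Z * s Z) :
    ∃ R, PolyF R ∧ ∀ Z, p (u Z, v Z) = p (u' Z, v' Z) + M Z * R Z := by
  obtain ⟨P, rfl⟩ := hp
  induction P using MvPolynomial.induction_on with
  | C a => exact ⟨fun _ => 0, PolyF.const 0, by intro Z; simp [ev]⟩
  | add p q hp hq =>
    obtain ⟨R, hR, hR'⟩ := hp
    obtain ⟨S, hS, hS'⟩ := hq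
    refine ⟨_, hR.add hS, fun Z => ?_⟩
    have e : ∀ W, ev (p + q) W = ev p W + ev q W := fun W => by simp [ev]
    rw [e, e, hR', hS']; ring
  | mul_X p i hp =>
    obtain ⟨R, hR, hR'⟩ := hp
    have hpc : PolyF (fun Z => ev p (u' Z, v' Z)) := PolyF.comp ⟨p, rfl⟩ hu' hv'
    fin_cases i
    · refine ⟨_, (hR.mul hu).add (hpc.mul hr), fun Z => ?_⟩
      have e : ∀ W, ev (p * MvPolynomial.X 0) W = ev p W * W.1 := fun W => by simp [ev]
      simp only [Fin.zero_eta]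
      rw [e, e, hR']; simp only [h1]; ring
    · refine ⟨_, (hR.mul hv).add (hpc.mul hs), fun Z => ?_⟩
      have e : ∀ W, ev (p * MvPolynomial.X 1) W = ev p W * W.2 := fun W => by simp [ev]
      simp only [Fin.mk_one]
      rw [e, e, hR']; simp only [h2]; ring

/-- binary forms -/
def Form (p : ℂ × ℂ → ℂ) (e : ℕ) : Prop :=
  PolyF p ∧ ∀ c : ℂ, c ≠ 0 → ∀ Z, p (c • Z) = c ^ e * p Z

lemma Form.smul {p e} (h : Form p e) (he : 1 ≤ e) (c : ℂ) (Z) : p (c • Z) = c ^ e * p Z := by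
  by_cases hc : c = 0
  · subst hc
    have h2 := h.2 2 two_ne_zero 0
    rw [smul_zero] at h2
    have : (2:ℂ) ^ e ≠ 1 := by
      intro h
      have h' : (2:ℕ) ^ e = 1 := by exact_mod_cast h
      have := Nat.one_lt_two_pow (n := e) (by omega)
      omega
    have h3 : ((2:ℂ) ^ e - 1) * p 0 = 0 := by linear_combination -h2
    have h4 := (_root_.mul_eq_zero.1 h3).resolve_left (sub_ne_zero.2 this)
    rw [zero_smul, h4, zero_pow (by omega), zero_mul]
  · exact h.2 c hc Z

/-- factorization into linear forms -/
def Fac (p : ℂ × ℂ → ℂ) (T : Multiset (ℂ × ℂ)) : Prop :=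
  ∀ Z, p Z = (T.map (fun t => wedge Z t)).prod

/-- product of norms -/
noncomputable def np (T : Multiset (ℂ × ℂ)) (f : ℂ × ℂ → ℂ) : ℝ := (T.map (fun t => ‖f t‖)).prod

lemma norm_mprod {α : Type*} (T : Multiset α) (f : α → ℂ) :
    ‖(T.map f).prod‖ = (T.map (fun t => ‖f t‖)).prod := by
  induction T using Multiset.induction_on with
  | empty => simp
  | cons a s ih => simp [ih]

lemma wedge_norm_comm (Z W) : ‖wedge Z W‖ = ‖wedge W Z‖ := by
  rw [← norm_neg]; congr 1; simp only [wedge]; ring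

lemma Fac.recip {p q S T} (hp : Fac p S) (hq : Fac q T) : np S q = np T p := by
  unfold np
  simp only [hp _, hq _, norm_mprod]
  rw [Multiset.prod_map_prod_map]
  simp only [wedge_norm_comm]

lemma np_mul (T f g) : np T (fun t => f t * g t) = np T f * np T g := by
  simp [np, Multiset.prod_map_mul]

lemma np_pow (T f) (e : ℕ) : np T (fun t => f t ^ e) = np T f ^ e := by
  simp [np, Multiset.prod_map_pow]

lemma np_const (T) (c : ℂ) : np T (fun _ => c) = ‖c‖ ^ (Multiset.card T) := by
  simp [np]

lemma np_congr {T f g} (h : ∀ t ∈ T, ‖f t‖ = ‖g t‖) : np T f = np T g := by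
  unfold np; rw [Multiset.map_congr rfl h]

lemma np_add (S T f) : np (S + T) f = np S f * np T f := by simp [np]

lemma Fac.np_wedge {p T} (h : Fac p T) (W) : np T (fun t => wedge t W) = ‖p W‖ := by
  rw [h W, norm_mprod]; unfold np; simp only [wedge_norm_comm]

lemma Fac.np_wedge' {p T} (h : Fac p T) (W) : np T (fun t => wedge W t) = ‖p W‖ := by
  rw [h W, norm_mprod]; rfl

lemma np_ne_zero {T f} (h : np T f ≠ 0) : ∀ t ∈ T, f t ≠ 0 := by
  intro t ht h0
  apply h
  unfold np
  rw [Multiset.prod_eq_zero_iff]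
  exact Multiset.mem_map.2 ⟨t, ht, by simp [h0]⟩

lemma Fac.root {p T} (h : Fac p T) : ∀ t ∈ T, p t = 0 := by
  intro t ht
  rw [h t, Multiset.prod_eq_zero_iff]
  exact Multiset.mem_map.2 ⟨t, ht, by simp only [wedge]; ring⟩

lemma Fac.ne_zero {p T} (h : Fac p T) (hp : ∃ Z, p Z ≠ 0) : ∀ t ∈ T, t ≠ 0 := by
  rintro t ht rfl
  obtain ⟨Z, hZ⟩ := hp
  apply hZ
  rw [h Z, Multiset.prod_eq_zero_iff]
  exact Multiset.mem_map.2 ⟨0, ht, by simp [wedge]⟩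

lemma wedge_smul_left (c : ℂ) (Z W) : wedge (c • Z) W = c * wedge Z W := by
  simp only [wedge, Prod.smul_fst, Prod.smul_snd, smul_eq_mul]; ring

lemma wedge_smul_right (c : ℂ) (Z W) : wedge Z (c • W) = c * wedge Z W := by
  simp only [wedge, Prod.smul_fst, Prod.smul_snd, smul_eq_mul]; ring

lemma Fac.smul {p T} (h : Fac p T) (c : ℂ) (Z) : p (c • Z) = c ^ (Multiset.card T) * p Z := by
  rw [h, h]
  simp only [wedge_smul_left]
  rw [Multiset.prod_map_mul]; simp

lemma Fac.card {p T e} (h : Fac p T) (hf : Form p e) (hp : ∃ Z, p Z ≠ 0) :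
    Multiset.card T = e := by
  obtain ⟨Z, hZ⟩ := hp
  have h1 := hf.2 2 two_ne_zero Z
  rw [h.smul] at h1
  have h2 : (2:ℂ) ^ (Multiset.card T) = 2 ^ e := mul_right_cancel₀ hZ h1
  have h3 : (2:ℕ) ^ (Multiset.card T) = 2 ^ e := by exact_mod_cast h2
  exact Nat.pow_right_injective le_rfl h3

lemma Fac.polyF {p T} (h : Fac p T) : PolyF p := by
  have : p = fun Z => (T.map (fun t => wedge Z t)).prod := funext h
  rw [this]
  clear h this
  induction T using Multiset.induction_on with
  | empty => simpa using PolyF.const 1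
  | cons a s ih =>
    simp only [Multiset.map_cons, Multiset.prod_cons]
    exact ((PolyF.fst.mul (PolyF.const a.2)).sub (PolyF.snd.mul (PolyF.const a.1))).mul ih

lemma exists_smul_of_wedge {Z W : ℂ × ℂ} (hW : W ≠ 0) (h : wedge Z W = 0) : ∃ c : ℂ, Z = c • W := by
  simp only [wedge] at h
  by_cases h1 : W.1 = 0
  · have h2 : W.2 ≠ 0 := fun h2 => hW (Prod.ext h1 h2)
    have : Z.1 = 0 := by simpa [h1, h2] using h
    refine ⟨Z.2 / W.2, Prod.ext ?_ ?_⟩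
    · simp [h1, this]
    · simp [h2]
  · refine ⟨Z.1 / W.1, Prod.ext ?_ ?_⟩
    · simp [h1]
    · simp; field_simp; linear_combination -h

lemma exists_wedge_ne {W : ℂ × ℂ} (hW : W ≠ 0) : ∃ U, wedge W U ≠ 0 := by
  by_cases h1 : W.1 = 0
  · have h2 : W.2 ≠ 0 := fun h2 => hW (Prod.ext h1 h2)
    exact ⟨(1, 0), by simpa [wedge] using h2⟩
  · exact ⟨(0, 1), by simpa [wedge] using h1⟩

lemma Form.exists_fac {p e} (hf : Form p e) (he : 1 ≤ e) :
    ∃ T, Multiset.card T = e ∧ Fac p T := by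
  obtain ⟨P, rfl⟩ := hf.1
  set q : Polynomial ℂ := MvPolynomial.aeval ![(1 : Polynomial ℂ), Polynomial.X] P with hq
  have hqe : ∀ w : ℂ, q.eval w = ev P (1, w) := by
    intro w
    rw [hq, ev, ← Polynomial.coe_evalRingHom, MvPolynomial.map_aeval]
    simp only [MvPolynomial.eval]
    congr 1
    ext i
    · simp
    · fin_cases i <;> simp
  have key : ∀ Z : ℂ × ℂ, Z.1 ≠ 0 → ev P Z = Z.1 ^ e * q.eval (Z.2 / Z.1) := by
    intro Z hZ
    rw [hqe, ← hf.2 _ hZ]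
    congr 1
    ext <;> simp
    field_simp
  by_cases hq0 : q = 0
  · refine ⟨Multiset.replicate e 0, by simp, fun Z => ?_⟩
    have : ∀ Z, ev P Z = (fun _ => (0:ℂ)) Z := by
      refine PolyF.cancel PolyF.fst hf.1 (PolyF.const 0) ⟨(1, 0), by simp⟩ ?_
      intro Z
      by_cases hZ : Z.1 = 0
      · simp [hZ]
      · rw [key Z hZ]; simp [hq0]
    rw [this]; simp [wedge, zero_pow (show e ≠ 0 by omega)]
  · set a := q.leadingCoeff
    have ha : a ≠ 0 := by simpa [a] using hq0
    set S : Multiset (ℂ × ℂ) := q.roots.map (fun r => (-1, -r)) with hS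
    have hev : ∀ w, q.eval w = a * (S.map (fun t => wedge (1, w) t)).prod := by
      intro w
      have := (IsAlgClosed.splits q).eval_eq_prod_roots (x := w)
      rw [this, hS, Multiset.map_map]
      congr 3
      ext r; simp [wedge]; ring
    have hScard : Multiset.card S = q.natDegree := by
      rw [hS, Multiset.card_map, ← (IsAlgClosed.splits q).natDegree_eq_card_roots]
    have hSF : Fac (fun Z => (S.map (fun t => wedge Z t)).prod) S := fun Z => rfl
    have hSh : ∀ Z : ℂ × ℂ, Z.1 ≠ 0 → Z.1 ^ q.natDegree * q.eval (Z.2 / Z.1) =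
        a * (S.map (fun t => wedge Z t)).prod := by
      intro Z hZ
      rw [hev]
      have := hSF.smul Z.1 (1, Z.2 / Z.1)
      have h2 : (Z.1 • ((1, Z.2 / Z.1) : ℂ × ℂ)) = Z := by ext <;> simp; field_simp
      rw [h2, hScard] at this
      rw [this]; ring
    have hle : q.natDegree ≤ e := by
      by_contra hlt
      push Not at hlt
      obtain ⟨k, hk⟩ := Nat.exists_eq_add_of_lt hlt
      have : ∀ Z : ℂ × ℂ, Z.1 ^ (k+1) * ev P Z = a * (S.map (fun t => wedge Z t)).prod := by
        refine PolyF.cancel PolyF.fst ((PolyF.fst.pow _).mul hf.1) ((PolyF.const a).mul hSF.polyF)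
          ⟨(1, 0), by simp⟩ ?_
        intro Z
        by_cases hZ : Z.1 = 0
        · simp [hZ]
        · congr 1
          rw [← hSh Z hZ, key Z hZ, hk]; ring
      have := this (0, 1)
      simp only [hS, Multiset.map_map] at this
      simp [wedge] at this
      exact ha this.symm
    set T0 : Multiset (ℂ × ℂ) := Multiset.replicate (e - q.natDegree) (0, 1) + S with hT0
    have hT0c : Multiset.card T0 = e := by
      rw [hT0, Multiset.card_add, hScard, Multiset.card_replicate]; omega
    have hP0 : ∀ Z, ev P Z = a * (T0.map (fun t => wedge Z t)).prod := by
      have hF : Fac (fun Z => (T0.map (fun t => wedge Z t)).prod) T0 := fun Z => rfl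
      refine PolyF.cancel PolyF.fst (hf.1) ((PolyF.const a).mul hF.polyF)
          ⟨(1, 0), by simp⟩ ?_
      intro Z
      by_cases hZ : Z.1 = 0
      · simp [hZ]
      · congr 1
        rw [key Z hZ, hT0, Multiset.map_add, Multiset.prod_add, Multiset.map_replicate,
          Multiset.prod_replicate]
        have : e = (e - q.natDegree) + q.natDegree := by omega
        conv_lhs => rw [this, pow_add, mul_assoc, hSh Z hZ]
        simp [wedge]; ring
    obtain ⟨t, T1, hT1⟩ : ∃ t T1, T0 = t ::ₘ T1 := by
      have : T0 ≠ 0 := by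
        intro h; rw [h] at hT0c; simp at hT0c; omega
      obtain ⟨t, ht⟩ := Multiset.exists_mem_of_ne_zero this
      exact ⟨t, _, (Multiset.cons_erase ht).symm⟩
    refine ⟨(a • t) ::ₘ T1, ?_, ?_⟩
    · rw [← hT0c, hT1]; simp
    · intro Z
      rw [hP0, hT1]; simp [wedge_smul_right, mul_assoc]

/-- homogeneous polynomial self-maps of `ℂ²` of degree `D` -/
def IsH (F : ℂ × ℂ → ℂ × ℂ) (D : ℕ) : Prop :=
  Form (fun Z => (F Z).1) D ∧ Form (fun Z => (F Z).2) D

lemma IsH.smul {F D} (h : IsH F D) (hD : 1 ≤ D) (c : ℂ) (Z) : F (c • Z) = c ^ D • F Z :=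
  Prod.ext (h.1.smul hD c Z) (h.2.smul hD c Z)

lemma IsH.comp {F H D E} (hF : IsH F D) (hH : IsH H E) : IsH (F ∘ H) (D * E) := by
  refine ⟨⟨hF.1.1.comp hH.1.1 hH.2.1, ?_⟩, ⟨hF.2.1.comp hH.1.1 hH.2.1, ?_⟩⟩
  · intro c hc Z
    have : H (c • Z) = c ^ E • H Z := Prod.ext (hH.1.2 c hc Z) (hH.2.2 c hc Z)
    have h2 := hF.1.2 (c ^ E) (pow_ne_zero _ hc) (H Z)
    simp only [Function.comp, this] at h2 ⊢
    rw [h2, ← pow_mul, mul_comm D E]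
  · intro c hc Z
    have : H (c • Z) = c ^ E • H Z := Prod.ext (hH.1.2 c hc Z) (hH.2.2 c hc Z)
    have h2 := hF.2.2 (c ^ E) (pow_ne_zero _ hc) (H Z)
    simp only [Function.comp, this] at h2 ⊢
    rw [h2, ← pow_mul, mul_comm D E]

lemma IsH.id : IsH (fun Z => Z) 1 :=
  ⟨⟨PolyF.fst, by intros; simp⟩, ⟨PolyF.snd, by intros; simp⟩⟩

lemma IsH.iterate {F D} (hF : IsH F D) (m : ℕ) : IsH (F^[m]) (D ^ m) := by
  induction m with
  | zero => rw [pow_zero, Function.iterate_zero]; exact IsH.id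
  | succ m ih => rw [Function.iterate_succ, pow_succ]; exact ih.comp hF

lemma IsH.wedge_form {F D} (hF : IsH F D) (V) : Form (fun Z => wedge (F Z) V) D := by
  refine ⟨(hF.1.1.mul (PolyF.const V.2)).sub (hF.2.1.mul (PolyF.const V.1)), ?_⟩
  intro c hc Z
  have h1 := hF.1.2 c hc Z
  have h2 := hF.2.2 c hc Z
  simp only [wedge] at *
  rw [h1, h2]; ring

lemma IsH.fix_form {F D} (hF : IsH F D) : Form (fun Z => wedge (F Z) Z) (D + 1) := by
  refine ⟨(hF.1.1.mul PolyF.snd).sub (hF.2.1.mul PolyF.fst), ?_⟩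
  intro c hc Z
  have h1 := hF.1.2 c hc Z
  have h2 := hF.2.2 c hc Z
  simp only [wedge] at *
  rw [h1, h2]; simp; ring

/-- `|Res F| = 1`, coordinate-free version -/
def Good (F : ℂ × ℂ → ℂ × ℂ) (D : ℕ) : Prop :=
  ∀ V, V ≠ 0 → ∃ T : Multiset (ℂ × ℂ), Multiset.card T = D ∧ (∀ t ∈ T, t ≠ 0) ∧
    Fac (fun Z => wedge (F Z) V) T ∧ ∀ W, np T (fun t => wedge (F t) W) = ‖wedge V W‖ ^ D

lemma mprod_congr_pow {α : Type*} (T : Multiset α) (f g : α → ℝ) (h : ∀ t ∈ T, f t = g t) :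
    (T.map f).prod = (T.map g).prod := by rw [Multiset.map_congr rfl h]

lemma np_bind (T : Multiset (ℂ × ℂ)) (S : ℂ × ℂ → Multiset (ℂ × ℂ)) (f) :
    np (T.bind S) f = (T.map (fun t => np (S t) f)).prod := by
  induction T using Multiset.induction_on with
  | empty => simp [np]
  | cons a s ih => rw [Multiset.cons_bind, np_add, ih]; simp

lemma Good.comp {F H D E} (hF : Good F D) (hH : Good H E) (hFH : IsH F D) (hD : 1 ≤ D) :
    Good (F ∘ H) (D * E) := by
  classical
  intro V hV
  obtain ⟨T, hTc, hT0, hTF, hTn⟩ := hF V hV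
  have hex : ∀ t : ℂ × ℂ, ∃ S : Multiset (ℂ × ℂ), t ≠ 0 → (Multiset.card S = E ∧ (∀ s ∈ S, s ≠ 0) ∧
    Fac (fun Z => wedge (H Z) t) S ∧ ∀ W, np S (fun s => wedge (H s) W) = ‖wedge t W‖ ^ E) := by
    intro t
    by_cases ht : t = 0
    · exact ⟨0, fun h => absurd ht h⟩
    · obtain ⟨S, hS⟩ := hH t ht
      exact ⟨S, fun _ => hS⟩
  choose S hS using hex
  refine ⟨T.bind S, ?_, ?_, ?_, ?_⟩
  · rw [Multiset.card_bind]
    have : T.map (Multiset.card ∘ S) = T.map (fun _ => E) :=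
      Multiset.map_congr rfl (fun t ht => (hS t (hT0 t ht)).1)
    rw [this]; simp [hTc]
  · intro s hs
    obtain ⟨t, ht, hst⟩ := Multiset.mem_bind.1 hs
    exact (hS t (hT0 t ht)).2.1 s hst
  · intro Z
    have h1 := hTF (H Z)
    simp only [Function.comp] at h1 ⊢
    rw [h1, Multiset.map_bind, Multiset.prod_bind]
    congr 1
    refine Multiset.map_congr rfl (fun t ht => ?_)
    exact (hS t (hT0 t ht)).2.2.1 Z
  · intro W
    rw [np_bind]
    have : ∀ t ∈ T, np (S t) (fun s => wedge ((F ∘ H) s) W) = ‖wedge (F t) W‖ ^ E := by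
      intro t ht
      obtain ⟨h1, h2, h3, h4⟩ := hS t (hT0 t ht)
      obtain ⟨U, hU⟩ := exists_wedge_ne (hT0 t ht)
      have e1 : np (S t) (fun s => wedge ((F ∘ H) s) W * wedge t U ^ D) =
          np (S t) (fun s => wedge (H s) U ^ D * wedge (F t) W) := by
        apply np_congr
        intro s hs
        obtain ⟨c, hc⟩ := exists_smul_of_wedge (hT0 t ht) (h3.root s hs)
        congr 1
        simp only [Function.comp]
        rw [hc, hFH.smul hD, wedge_smul_left, wedge_smul_left]; ring
      rw [np_mul, np_mul, np_pow, np_pow, np_const, np_const, h4, h1, mul_comm] at e1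
      exact mul_left_cancel₀ (pow_ne_zero _ (pow_ne_zero _ (norm_ne_zero_iff.2 hU))) e1
    rw [mprod_congr_pow _ _ _ this]
    have h5 := hTn W
    unfold np at h5
    rw [Multiset.prod_map_pow, h5, pow_mul]

lemma Good.iterate {F D} (hF : Good F D) (hFH : IsH F D) (hD : 1 ≤ D) (m : ℕ) :
    Good (F^[m + 1]) (D ^ (m + 1)) := by
  induction m with
  | zero => simpa using hF
  | succ m ih =>
    rw [Function.iterate_succ, pow_succ]
    exact ih.comp hF (hFH.iterate _) (Nat.one_le_pow _ _ hD)

lemma Good.iterate' {F D} (hF : Good F D) (hFH : IsH F D) (hD : 1 ≤ D) {m : ℕ} (hm : 1 ≤ m) :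
    Good (F^[m]) (D ^ m) := by
  obtain ⟨k, rfl⟩ := Nat.exists_eq_add_of_le' hm
  exact hF.iterate hFH hD k

lemma Good.fix_ne {F D} (hF : Good F D) (hD : 2 ≤ D) : ∃ W, wedge (F W) W ≠ 0 := by
  by_contra hcon
  push Not at hcon
  obtain ⟨T, hTc, hT0, hTF, hTn⟩ := hF (0, 1) (by simp)
  obtain ⟨S, hSc, hS0, hSF, hSn⟩ := hF (1, 0) (by simp)
  have h1 : ∀ t ∈ T, t.1 = 0 := by
    intro t ht
    have a := np_ne_zero (T := T) (f := fun t => wedge (F t) (1, 0))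
      (by rw [hTn]; simp [wedge]) t ht
    have b := hTF.root t ht
    have c := hcon t
    simp [wedge] at a b c
    simpa [b, a] using c
  have h2 : ∀ t ∈ S, t.2 = 0 := by
    intro t ht
    have a := np_ne_zero (T := S) (f := fun t => wedge (F t) (0, 1))
      (by rw [hSn]; simp [wedge]) t ht
    have b := hSF.root t ht
    have c := hcon t
    simp [wedge] at a b c
    simpa [b, a] using c
  have e1 : ∀ Z, (F Z).1 = Z.1 ^ D * (T.map (fun t => t.2)).prod := by
    intro Z
    have := hTF Z
    have h : T.map (fun t => wedge Z t) = T.map (fun t => Z.1 * t.2) :=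
      Multiset.map_congr rfl (fun t ht => by simp [wedge, h1 t ht])
    rw [h, Multiset.prod_map_mul] at this
    simpa [wedge, hTc] using this
  have e2 : ∀ Z, (F Z).2 = Z.2 ^ D * -(S.map (fun t => - t.1)).prod := by
    intro Z
    have := hSF Z
    have h : S.map (fun t => wedge Z t) = S.map (fun t => Z.2 * -t.1) :=
      Multiset.map_congr rfl (fun t ht => by simp [wedge, h2 t ht])
    rw [h, Multiset.prod_map_mul] at this
    simp [wedge, hSc] at this
    linear_combination -this
  set α := (T.map (fun t => t.2)).prod with hα
  have hα0 : α ≠ 0 := by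
    rw [hα]
    intro h
    rw [Multiset.prod_eq_zero_iff, Multiset.mem_map] at h
    obtain ⟨t, ht, ht2⟩ := h
    exact hT0 t ht (Prod.ext (h1 t ht) ht2)
  have c1 := hcon (1, 1)
  have c2 := hcon (2, 1)
  simp only [wedge, e1, e2] at c1 c2
  obtain ⟨k, rfl⟩ := Nat.exists_eq_add_of_le hD
  simp only [one_pow] at c1 c2
  have : α * 2 * ((2:ℂ) ^ (k + 1) - 1) = 0 := by
    rw [pow_add] at c2
    rw [pow_succ]
    linear_combination c2 - 2 * c1
  have h3 : (2:ℂ) ^ (k + 1) ≠ 1 := by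
    intro h
    have h' : (2:ℕ) ^ (k + 1) = 1 := by exact_mod_cast h
    have := Nat.one_lt_two_pow (n := k + 1) (by omega)
    omega
  simp [hα0, sub_eq_zero, h3] at this

lemma Good.fix {F D} (hF : Good F D) (hD : 2 ≤ D) {T} (hT : Fac (fun Z => wedge (F Z) Z) T)
    (c : ℂ × ℂ → ℂ) (hc : ∀ t ∈ T, F t = c t • t) : np T c = 1 := by
  obtain ⟨W, hW⟩ := hF.fix_ne hD
  have hW0 : W ≠ 0 := by rintro rfl; simp [wedge] at hW
  obtain ⟨S, hSc, hS0, hSF, hSn⟩ := hF W hW0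
  obtain ⟨U, hU⟩ := exists_wedge_ne hW0
  have h1 : np T (fun t => wedge (F t) W) = np S (fun t => wedge (F t) t) := hT.recip hSF
  have h2 : np T (fun t => wedge (F t) W) = np T c * ‖wedge (F W) W‖ := by
    rw [← hT.np_wedge W, ← np_mul]
    exact np_congr (fun t ht => by rw [← wedge_smul_left, ← hc t ht])
  have h3 : np S (fun t => wedge (F t) t * wedge W U) =
      np S (fun t => wedge (F t) U * wedge W t) := by
    refine np_congr (fun t ht => ?_)
    obtain ⟨e, he⟩ := exists_smul_of_wedge hW0 (hSF.root t ht)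
    rw [he, wedge_smul_left, wedge_smul_left]; congr 1; ring
  rw [np_mul, np_mul, np_const, hSn, hSc, hSF.np_wedge', mul_comm] at h3
  have h4 := mul_left_cancel₀ (pow_ne_zero _ (norm_ne_zero_iff.2 hU)) h3
  rw [h2, h4] at h1
  exact mul_right_cancel₀ (norm_ne_zero_iff.2 hW) (h1.trans (one_mul _).symm)

/-- the base case -/
lemma good_base {F : ℂ × ℂ → ℂ × ℂ} {d : ℕ} (hd : 1 ≤ d) (hF : IsH F d)
    (hnz : ∀ Z, F Z = 0 → Z = 0) {S : Multiset (ℂ × ℂ)} (hSc : Multiset.card S = d)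
    (hS : Fac (fun Z => (F Z).1) S) (hr : np S (fun Z => (F Z).2) = 1) : Good F d := by
  -- no form `F ∧ V` vanishes identically
  have hne : ∀ V, V ≠ 0 → ∃ Z, wedge (F Z) V ≠ 0 := by
    intro V hV
    by_contra hcon
    push Not at hcon
    obtain ⟨W, hW⟩ := exists_wedge_ne hV
    have hVW : ∀ Z, wedge (F Z) W = 0 → Z = 0 := by
      intro Z hZ
      obtain ⟨c, hc⟩ := exists_smul_of_wedge hV (hcon Z)
      rw [hc, wedge_smul_left] at hZ
      have : c = 0 := (_root_.mul_eq_zero.1 hZ).resolve_right hW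
      exact hnz Z (by rw [hc, this, zero_smul])
    obtain ⟨T, hTc, hT⟩ := (hF.wedge_form W).exists_fac hd
    have hTne : T ≠ 0 := by rintro rfl; simp at hTc; omega
    obtain ⟨t, ht⟩ := Multiset.exists_mem_of_ne_zero hTne
    have := hVW t (hT.root t ht)
    refine hT.ne_zero ⟨(1, 0), fun h => ?_⟩ t ht this
    simpa using hVW _ h
  have key : ∀ V, V ≠ 0 → V.1 ≠ 0 → ∀ T, Fac (fun Z => wedge (F Z) V) T → ∀ W,
      np T (fun t => wedge (F t) W) = ‖wedge V W‖ ^ d := by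
    intro V hV hV1 T hT W
    have hTc := hT.card (hF.wedge_form V) (hne V hV)
    have h1 : np T (fun t => (F t).1) = np S (fun t => wedge (F t) V) := hT.recip hS
    have h2 : np S (fun t => wedge (F t) V) = np S (fun t => (F t).2 * V.1) := by
      refine np_congr (fun t ht => ?_)
      have := hS.root t ht
      simp [wedge, this]
    rw [np_mul, hr, np_const, hSc, one_mul] at h2
    have h3 : np T (fun t => wedge (F t) W * V.1) = np T (fun t => (F t).1 * wedge V W) := by
      refine np_congr (fun t ht => ?_)
      obtain ⟨e, he⟩ := exists_smul_of_wedge hV (hT.root t ht)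
      rw [he, wedge_smul_left]; congr 1; simp; ring
    rw [np_mul, np_mul, np_const, np_const, hTc, h1, h2, mul_comm] at h3
    exact mul_left_cancel₀ (pow_ne_zero _ (norm_ne_zero_iff.2 hV1)) h3
  intro V hV
  obtain ⟨T, hTc, hT⟩ := (hF.wedge_form V).exists_fac hd
  refine ⟨T, hTc, hT.ne_zero (hne V hV), hT, fun W => ?_⟩
  by_cases hV1 : V.1 = 0
  · set U : ℂ × ℂ := (1, 0) with hUdef
    have hU : wedge V U ≠ 0 := by
      have h2 : V.2 ≠ 0 := fun h2 => hV (Prod.ext hV1 h2)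
      simpa [wedge, hUdef] using h2
    have hU0 : U ≠ 0 := by simp [hUdef]
    obtain ⟨T', hTc', hT'⟩ := (hF.wedge_form U).exists_fac hd
    have a := key U hU0 (by simp [hUdef]) T' hT' V
    have b : np T (fun t => wedge (F t) U) = np T' (fun t => wedge (F t) V) := hT.recip hT'
    rw [a, wedge_norm_comm] at b
    have h3 : np T (fun t => wedge (F t) W * wedge V U) =
        np T (fun t => wedge (F t) U * wedge V W) := by
      refine np_congr (fun t ht => ?_)
      obtain ⟨e, he⟩ := exists_smul_of_wedge hV (hT.root t ht)
      rw [he, wedge_smul_left, wedge_smul_left]; congr 1; ring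
    rw [np_mul, np_mul, np_const, np_const, hTc, b, mul_comm] at h3
    exact mul_left_cancel₀ (pow_ne_zero _ (norm_ne_zero_iff.2 hU)) h3
  · exact key V hV hV1 T hT W

lemma IsH.cong {K H E D'} (hK : IsH K E) (hH : IsH H D') (hD : 1 ≤ D') (W : ℂ × ℂ) :
    ∃ R, PolyF R ∧ ∀ Z, wedge Z W ^ D' * wedge (H (K Z)) Z =
      wedge (K Z) W ^ D' * wedge (H Z) Z + wedge (K Z) Z * R Z := by
  have w1 : PolyF (fun Z => wedge Z W) := (IsH.id.wedge_form W).1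
  have w2 : PolyF (fun Z => wedge (K Z) W) := (hK.wedge_form W).1
  have i1 : ∀ Z, (wedge Z W * (K Z).1) = wedge (K Z) W * Z.1 + wedge (K Z) Z * (fun _ => -W.1) Z := by
    intro Z; simp only [wedge]; ring
  have i2 : ∀ Z, (wedge Z W * (K Z).2) = wedge (K Z) W * Z.2 + wedge (K Z) Z * (fun _ => -W.2) Z := by
    intro Z; simp only [wedge]; ring
  obtain ⟨R1, hR1, e1⟩ := PolyF.div hH.1.1 (w1.mul hK.1.1) (w1.mul hK.2.1) (w2.mul PolyF.fst)
    (w2.mul PolyF.snd) (PolyF.const (-W.1)) (PolyF.const (-W.2)) i1 i2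
  obtain ⟨R2, hR2, e2⟩ := PolyF.div hH.2.1 (w1.mul hK.1.1) (w1.mul hK.2.1) (w2.mul PolyF.fst)
    (w2.mul PolyF.snd) (PolyF.const (-W.1)) (PolyF.const (-W.2)) i1 i2
  refine ⟨_, (hR1.mul PolyF.snd).sub (hR2.mul PolyF.fst), fun Z => ?_⟩
  have a1 := e1 Z
  have a2 := e2 Z
  have b1 : ((wedge Z W * (K Z).1, wedge Z W * (K Z).2) : ℂ × ℂ) = wedge Z W • K Z := rfl
  have b2 : ((wedge (K Z) W * Z.1, wedge (K Z) W * Z.2) : ℂ × ℂ) = wedge (K Z) W • Z := rfl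
  rw [b1, b2, hH.smul hD, hH.smul hD] at a1 a2
  simp only [Prod.smul_fst, Prod.smul_snd, smul_eq_mul] at a1 a2
  generalize wedge Z W ^ D' = x at *
  generalize wedge (K Z) W ^ D' = y at *
  generalize wedge (K Z) Z = m at *
  simp only [wedge]
  linear_combination Z.2 * a1 - Z.1 * a2

lemma PolyF.dvd_of {p g s : ℂ × ℂ → ℂ} (hp : PolyF p) (hg : PolyF g) (hs : PolyF s)
    (hg0 : g (0, 1) ≠ 0) (N : ℕ) (h : ∀ Z, Z.1 ^ N * p Z = g Z * s Z) :
    ∃ q, PolyF q ∧ ∀ Z, p Z = g Z * q Z := by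
  obtain ⟨P, rfl⟩ := hp; obtain ⟨G, rfl⟩ := hg; obtain ⟨S, rfl⟩ := hs
  have e : (MvPolynomial.X 0) ^ N * P = G * S := by
    apply ev_ext; intro Z
    rw [ev_mul, ev_mul, ← h]; simp [ev]
  have hX : Prime (MvPolynomial.X 0 : MvPolynomial (Fin 2) ℂ) := MvPolynomial.X_prime
  have hnd : ¬ (MvPolynomial.X 0 : MvPolynomial (Fin 2) ℂ) ∣ G := by
    rintro ⟨G', rfl⟩
    apply hg0; simp [ev]
  obtain ⟨S', rfl⟩ := hX.pow_dvd_of_dvd_mul_left N hnd ⟨P, e.symm⟩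
  refine ⟨ev S', ⟨S', rfl⟩, fun Z => ?_⟩
  have : P = G * S' := by
    apply mul_left_cancel₀ (pow_ne_zero N hX.ne_zero)
    rw [e]; ring
  rw [this, ev_mul]

lemma exists_quot {G D} (hG : IsH G D) (hD : 1 ≤ D) (h01 : wedge (G (0, 1)) (0, 1) ≠ 0) (b : ℕ) :
    ∃ Q, PolyF Q ∧ ∀ Z, wedge (G^[b] Z) Z = wedge (G Z) Z * Q Z := by
  induction b with
  | zero => exact ⟨fun _ => 0, PolyF.const 0, fun Z => by simp [wedge]; ring⟩
  | succ b ih =>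
    obtain ⟨Q, hQ, hQe⟩ := ih
    obtain ⟨R, hR, hRe⟩ := hG.cong (hG.iterate b) (Nat.one_le_pow _ _ hD) (0, 1)
    have hf := (hG.iterate (b+1)).fix_form.1
    refine PolyF.dvd_of hf hG.fix_form.1
      ((((hG.wedge_form (0, 1)).1.pow (D ^ b)).mul hQ).add hR) h01 (D ^ b) (fun Z => ?_)
    have := hRe Z
    rw [hQe] at this
    have h1 : wedge Z (0, 1) = Z.1 := by simp [wedge]
    rw [h1] at this
    rw [Function.iterate_succ, Function.comp, this]; ring

/-- exponents for iterating on a fixed direction -/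
def es (D : ℕ) : ℕ → ℕ
  | 0 => 0
  | a + 1 => es D a * D + 1

lemma IsH.iterate_fix {G D} (hG : IsH G D) (hD : 1 ≤ D) {t : ℂ × ℂ} {c : ℂ} (h : G t = c • t) (a : ℕ) :
    G^[a] t = c ^ (es D a) • t := by
  induction a with
  | zero => simp [es]
  | succ a ih =>
    rw [Function.iterate_succ_apply', ih, hG.smul hD, h, smul_smul, es, pow_succ, pow_mul]

lemma exists_scale (F : ℂ × ℂ → ℂ × ℂ) :
    ∃ c : ℂ × ℂ → ℂ, ∀ t, t ≠ 0 → wedge (F t) t = 0 → F t = c t • t := by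
  have : ∀ t, ∃ c : ℂ, t ≠ 0 → wedge (F t) t = 0 → F t = c • t := by
    intro t
    by_cases h : t ≠ 0 ∧ wedge (F t) t = 0
    · obtain ⟨c, hc⟩ := exists_smul_of_wedge h.1 h.2
      exact ⟨c, fun _ _ => hc⟩
    · exact ⟨0, fun h1 h2 => absurd ⟨h1, h2⟩ h⟩
  choose c hc using this
  exact ⟨c, hc⟩

lemma Fac.mul {p q S T} (hp : Fac p S) (hq : Fac q T) : Fac (fun Z => p Z * q Z) (S + T) := by
  intro Z
  show p Z * q Z = _
  rw [hp Z, hq Z]; simp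

lemma Fac.congr {p q T} (hp : Fac p T) (h : ∀ Z, q Z = p Z) : Fac q T := fun Z => by rw [h, hp Z]

lemma quot_form {G D} (hG : IsH G D) (hD : 2 ≤ D)
    (h01 : wedge (G (0, 1)) (0, 1) ≠ 0) {Q b} (hb : 1 ≤ b) (hQ : PolyF Q)
    (hQe : ∀ Z, wedge (G^[b] Z) Z = wedge (G Z) Z * Q Z) : Form Q (D ^ b - D) := by
  refine ⟨hQ, fun c hc => ?_⟩
  have hle : D ≤ D ^ b := Nat.le_self_pow (by omega) D
  refine PolyF.cancel hG.fix_form.1 (?_ : PolyF (fun Z => Q (c • Z)))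
    ((PolyF.const (c ^ (D ^ b - D))).mul hQ) ⟨_, h01⟩ (fun Z => ?_)
  · exact hQ.comp ((PolyF.const c).mul PolyF.fst) ((PolyF.const c).mul PolyF.snd)
  · have h1 : wedge (G^[b] (c • Z)) (c • Z) = c ^ (D ^ b + 1) * wedge (G^[b] Z) Z :=
      (hG.iterate b).fix_form.2 c hc Z
    have h2 : wedge (G (c • Z)) (c • Z) = c ^ (D + 1) * wedge (G Z) Z := hG.fix_form.2 c hc Z
    simp only [hQe] at h1
    rw [h2] at h1
    have h3 : c ^ (D ^ b + 1) = c ^ (D + 1) * c ^ (D ^ b - D) := by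
      rw [← pow_add]; congr 1; omega
    rw [h3] at h1
    apply mul_left_cancel₀ (pow_ne_zero (D + 1) hc)
    linear_combination h1

lemma np_quot {G D} (hG : IsH G D) (hg : Good G D) (hD : 2 ≤ D)
    (h01 : wedge (G (0, 1)) (0, 1) ≠ 0) {Q a} (ha : 1 ≤ a)
    (hQe : ∀ Z, wedge (G^[a] Z) Z = wedge (G Z) Z * Q Z) {T} (hT : Fac Q T) :
    ∃ c : ℂ × ℂ → ℂ, (∀ t ∈ T, t ≠ 0 ∧ G^[a] t = c t • t) ∧ np T c = 1 := by
  obtain ⟨T1, -, hT1⟩ := hG.fix_form.exists_fac (by omega)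
  have hDa : 2 ≤ D ^ a := hD.trans (Nat.le_self_pow (by omega) D)
  have hga := hg.iterate' hG (by omega) ha
  have hfac : Fac (fun Z => wedge (G^[a] Z) Z) (T1 + T) := (hT1.mul hT).congr hQe
  obtain ⟨c, hc⟩ := exists_scale (G^[a])
  obtain ⟨c1, hc1⟩ := exists_scale G
  have hne := hfac.ne_zero (hga.fix_ne hDa)
  have hall : ∀ t ∈ T1 + T, G^[a] t = c t • t := fun t ht => hc t (hne t ht) (hfac.root t ht)
  have hn := hga.fix hDa hfac c hall
  have hall1 : ∀ t ∈ T1, G t = c1 t • t := fun t ht =>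
    hc1 t (hne t (Multiset.mem_add.2 (Or.inl ht))) (hT1.root t ht)
  have hn1 := hg.fix hD hT1 c1 hall1
  have : np T1 c = 1 := by
    have : np T1 c = np T1 (fun t => c1 t ^ es D a) := by
      refine np_congr (fun t ht => ?_)
      have ht' : t ∈ T1 + T := Multiset.mem_add.2 (Or.inl ht)
      have h1 := hall t ht'
      rw [hG.iterate_fix (by omega) (hall1 t ht)] at h1
      rw [smul_left_injective ℂ (hne t ht') h1]
    rw [this, np_pow, hn1, one_pow]
  rw [np_add, this, one_mul] at hn
  refine ⟨c, fun t ht => ?_, hn⟩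
  have ht' : t ∈ T1 + T := Multiset.mem_add.2 (Or.inr ht)
  exact ⟨hne t ht', hall t ht'⟩

lemma quot_step {G D} (hG : IsH G D) (hD : 2 ≤ D)
    (h01 : wedge (G (0, 1)) (0, 1) ≠ 0) {Q : ℕ → ℂ × ℂ → ℂ} (hQ : ∀ b, PolyF (Q b))
    (hQe : ∀ b Z, wedge (G^[b] Z) Z = wedge (G Z) Z * Q b Z) (a b : ℕ) {t : ℂ × ℂ} {c : ℂ}
    (ht : t ≠ 0) (hta : Q a t = 0) (hc : G^[a] t = c • t) :
    Q (b + a) t = c ^ (D ^ b) * Q b t := by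
  obtain ⟨W, hW⟩ := exists_wedge_ne ht
  obtain ⟨R, hR, hRe⟩ := (hG.iterate a).cong (hG.iterate b) (Nat.one_le_pow _ _ (by omega)) W
  have w1 : PolyF (fun Z => wedge Z W) := (IsH.id.wedge_form W).1
  have w2 : PolyF (fun Z => wedge (G^[a] Z) W) := ((hG.iterate a).wedge_form W).1
  have := PolyF.cancel hG.fix_form.1 ((w1.pow (D ^ b)).mul (hQ (b + a)))
    (((w2.pow (D ^ b)).mul (hQ b)).add ((hQ a).mul hR)) ⟨_, h01⟩ (fun Z => by
      have h1 := hRe Z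
      rw [← Function.iterate_add_apply, hQe, hQe, hQe] at h1
      linear_combination h1) t
  simp only [hta, hc, wedge_smul_left, mul_pow] at this
  apply mul_left_cancel₀ (pow_ne_zero (D ^ b) hW)
  linear_combination this

lemma unit_quot {G D} (hG : IsH G D) (hg : Good G D) (hD : 2 ≤ D)
    (h01 : wedge (G (0, 1)) (0, 1) ≠ 0) {Q : ℕ → ℂ × ℂ → ℂ} (hQ : ∀ b, PolyF (Q b))
    (hQe : ∀ b Z, wedge (G^[b] Z) Z = wedge (G Z) Z * Q b Z) :
    ∀ s a b : ℕ, a + b = s → 1 ≤ a → 1 ≤ b → a.Coprime b → ∀ T, Fac (Q a) T → np T (Q b) = 1 := by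
  have hQ1 : ∀ Z, Q 1 Z = 1 := PolyF.cancel hG.fix_form.1 (hQ 1) (PolyF.const 1) ⟨_, h01⟩
      (fun Z => by rw [← hQe]; simp)
  intro s
  induction s using Nat.strong_induction_on with
  | _ s ih =>
  intro a b hab ha hb hcop T hT
  -- the case `a < b`
  have main : ∀ a b : ℕ, a + b = s → 1 ≤ a → a < b → a.Coprime b → ∀ T, Fac (Q a) T →
      np T (Q b) = 1 := by
    intro a b hab ha hlt hcop T hT
    obtain ⟨k, rfl⟩ := Nat.exists_eq_add_of_lt hlt
    have e : a + k + 1 = (k + 1) + a := by ring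
    rw [e] at hcop ⊢
    obtain ⟨c, hc, hcn⟩ := np_quot hG hg hD h01 ha (hQe a) hT
    have : np T (Q (k + 1 + a)) = np T (fun t => c t ^ D ^ (k + 1) * Q (k + 1) t) :=
      np_congr (fun t ht => by
        rw [quot_step hG hD h01 hQ hQe a (k + 1) (hc t ht).1 (hT.root t ht) (hc t ht).2])
    rw [this, np_mul, np_pow, hcn, one_pow, one_mul]
    refine ih (a + (k + 1)) (by omega) a (k + 1) rfl ha (by omega) ?_ T hT
    simpa using hcop
  rcases lt_trichotomy a b with h | h | h
  · exact main a b hab ha h hcop T hT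
  · subst h
    have : a = 1 := by simpa using hcop
    subst this
    rw [show Q 1 = fun _ => 1 from funext hQ1, np_const]; simp
  · by_cases hb1 : b = 1
    · subst hb1
      rw [show Q 1 = fun _ => 1 from funext hQ1, np_const]; simp
    · have hlt : D < D ^ b := by
        calc D = D ^ 1 := (pow_one D).symm
          _ < D ^ b := Nat.pow_lt_pow_right (by omega) (by omega)
      obtain ⟨S, -, hS⟩ := (quot_form hG hD h01 hb (hQ b) (hQe b)).exists_fac (by omega)
      rw [hT.recip hS]
      exact main b a (by omega) hb h hcop.symm S hS

lemma Fac.prod {Φ : ℕ → ℂ × ℂ → ℂ} {T : ℕ → Multiset (ℂ × ℂ)} (h : ∀ k, Fac (Φ k) (T k))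
    (s : Finset ℕ) : Fac (fun Z => ∏ k ∈ s, Φ k Z) (∑ k ∈ s, T k) := by
  induction s using Finset.induction_on with
  | empty => intro Z; simp
  | insert a s ha ih =>
    intro Z
    simp only [Finset.prod_insert ha, Finset.sum_insert ha]
    exact (h a).mul ih Z

lemma np_sum (T : ℕ → Multiset (ℂ × ℂ)) (f) (s : Finset ℕ) :
    np (∑ k ∈ s, T k) f = ∏ k ∈ s, np (T k) f := by
  induction s using Finset.induction_on with
  | empty => simp [np]
  | insert a s ha ih => rw [Finset.sum_insert ha, np_add, ih, Finset.prod_insert ha]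

lemma np_prod (T) (f : ℕ → ℂ × ℂ → ℂ) (s : Finset ℕ) :
    np T (fun t => ∏ k ∈ s, f k t) = ∏ k ∈ s, np T (f k) := by
  induction s using Finset.induction_on with
  | empty => simp [np]
  | insert a s ha ih => simp only [Finset.prod_insert ha]; rw [np_mul, ih]

/-- dynatomic data -/
structure Dyn (F : ℂ × ℂ → ℂ × ℂ) (d n : ℕ) (T : ℕ → Multiset (ℂ × ℂ))
    (Φ : ℕ → ℂ × ℂ → ℂ) : Prop where
  hH : IsH F d
  hg : Good F d
  hd : 2 ≤ d
  hn : n ≠ 0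
  fac : ∀ k, Fac (Φ k) (T k)
  dyn : ∀ m, m ∣ n → ∀ Z, wedge (F^[m] Z) Z = ∏ k ∈ m.divisors, Φ k Z
  h01 : ∀ k, k ∣ n → Φ k (0, 1) ≠ 0

namespace Dyn
variable {F : ℂ × ℂ → ℂ × ℂ} {d n : ℕ} {T : ℕ → Multiset (ℂ × ℂ)} {Φ : ℕ → ℂ × ℂ → ℂ}

lemma ne_zero (h : Dyn F d n T Φ) {k} (hk : k ∣ n) : ∀ t ∈ T k, t ≠ 0 :=
  (h.fac k).ne_zero ⟨_, h.h01 k hk⟩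

lemma pos (h : Dyn F d n T Φ) {k} (hk : k ∣ n) : 1 ≤ k :=
  Nat.pos_of_ne_zero (fun h0 => h.hn (by subst h0; simpa using hk))

lemma deg (h : Dyn F d n T Φ) {k} (hk : k ∣ n) : 2 ≤ d ^ k :=
  h.hd.trans (Nat.le_self_pow (by have := h.pos hk; omega) d)

lemma wedge01 (h : Dyn F d n T Φ) {m} (hm : m ∣ n) : wedge (F^[m] (0, 1)) (0, 1) ≠ 0 := by
  rw [h.dyn m hm, Finset.prod_ne_zero_iff]
  intro k hk
  exact h.h01 k ((Nat.dvd_of_mem_divisors hk).trans hm)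

lemma root (h : Dyn F d n T Φ) {l m} (hl : l ∣ m) (hm : m ∣ n) : ∀ t ∈ T l, wedge (F^[m] t) t = 0 := by
  intro t ht
  rw [h.dyn m hm]
  exact Finset.prod_eq_zero (Nat.mem_divisors.2 ⟨hl, by have := h.pos hm; omega⟩) ((h.fac l).root t ht)

lemma scale (h : Dyn F d n T Φ) : ∀ k, k ∣ n → ∀ c : ℂ × ℂ → ℂ, (∀ t ∈ T k, F^[k] t = c t • t) →
    np (T k) c = 1 := by
  intro k
  induction k using Nat.strong_induction_on with
  | _ k ih =>
  intro hk c hc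
  have hk1 := h.pos hk
  obtain ⟨C, hC⟩ := exists_scale (F^[k])
  have hCl : ∀ l, l ∣ k → ∀ t ∈ T l, F^[k] t = C t • t := fun l hl t ht =>
    hC t (h.ne_zero (hl.trans hk) t ht) (h.root hl hk t ht)
  have tot : np (∑ l ∈ k.divisors, T l) C = 1 := by
    refine (h.hg.iterate' h.hH (by have := h.hd; omega) hk1).fix (h.deg hk) 
      ((Fac.prod h.fac k.divisors).congr (fun Z => h.dyn k hk Z)) C ?_
    intro t ht
    rw [Multiset.mem_sum] at ht
    obtain ⟨l, hl, ht⟩ := ht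
    exact hCl l (Nat.dvd_of_mem_divisors hl) t ht
  rw [np_sum, ← Nat.cons_self_properDivisors (by omega), Finset.prod_cons, Finset.prod_eq_one,
    mul_one] at tot
  · rw [← tot]
    refine np_congr (fun t ht => ?_)
    have h1 := hCl k dvd_rfl t ht
    rw [hc t ht] at h1
    rw [smul_left_injective ℂ (h.ne_zero hk t ht) h1]
  · intro l hl
    rw [Nat.mem_properDivisors] at hl
    obtain ⟨c1, hc1⟩ := exists_scale (F^[l])
    have hln := hl.1.trans hk
    have hall : ∀ t ∈ T l, F^[l] t = c1 t • t := fun t ht =>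
      hc1 t (h.ne_zero hln t ht) (h.root dvd_rfl hln t ht)
    have i1 := ih l hl.2 hln c1 hall
    have : np (T l) C = np (T l) (fun t => c1 t ^ es (d ^ l) (k / l)) := by
      refine np_congr (fun t ht => ?_)
      have h1 := hCl l hl.1 t ht
      have h2 := (h.hH.iterate l).iterate_fix (by have := h.deg hln; omega) (hall t ht) (k / l)
      rw [← Function.iterate_mul, Nat.mul_div_cancel' hl.1, h1] at h2
      rw [smul_left_injective ℂ (h.ne_zero hln t ht) h2]
    rw [this, np_pow, i1, one_pow]

lemma incomp (h : Dyn F d n T Φ) : ∀ s a b, a + b = s → a ∣ n → b ∣ n → ¬ a ∣ b → ¬ b ∣ a →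
    np (T a) (Φ b) = 1 := by
  intro s
  induction s using Nat.strong_induction_on with
  | _ s ih =>
  intro a b hs ha hb hab hba
  set g := a.gcd b with hgdef
  have hga : g ∣ a := Nat.gcd_dvd_left a b
  have hgb : g ∣ b := Nat.gcd_dvd_right a b
  have hgn := hga.trans ha
  have pa := h.pos ha
  have pb := h.pos hb
  have pg := h.pos hgn
  have hG := h.hH.iterate g
  have dg := h.deg hgn
  choose Q hQ hQe using exists_quot hG (by omega) (h.wedge01 hgn)
  have key : ∀ m, m ∣ n → g ∣ m → Q (m / g) = fun Z => ∏ k ∈ m.divisors \ g.divisors, Φ k Z := by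
    intro m hm hgm
    funext Z
    refine PolyF.cancel hG.fix_form.1 (hQ _) (Fac.prod h.fac _).polyF ⟨_, h.wedge01 hgn⟩ (fun Z => ?_) Z
    have := hQe (m / g) Z
    rw [← Function.iterate_mul, Nat.mul_div_cancel' hgm] at this
    rw [← this, h.dyn m hm, h.dyn g hgn, mul_comm, Finset.prod_sdiff]
    exact Nat.divisors_subset_of_dvd (by have := h.pos hm; omega) hgm
  have hu := unit_quot hG (h.hg.iterate' h.hH (by have := h.hd; omega) pg) dg (h.wedge01 hgn) hQ hQe
    _ (a / g) (b / g) rfl (Nat.div_pos (Nat.le_of_dvd pa hga) pg)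
    (Nat.div_pos (Nat.le_of_dvd pb hgb) pg) (Nat.coprime_div_gcd_div_gcd pg)
    (∑ k ∈ a.divisors \ g.divisors, T k) (by rw [key a ha hga]; exact Fac.prod h.fac _)
  rw [key b hb hgb, np_sum] at hu
  simp only [np_prod] at hu
  have hdv : ∀ m k, k ∈ m.divisors \ g.divisors → k ∣ m ∧ ¬ k ∣ g := by
    intro m k hk
    simp only [Finset.mem_sdiff, Nat.mem_divisors, not_and_or] at hk
    exact ⟨hk.1.1, hk.2.resolve_right (by omega)⟩
  have one : ∀ k ∈ a.divisors \ g.divisors, ∀ l ∈ b.divisors \ g.divisors, ¬ (k = a ∧ l = b) →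
      np (T k) (Φ l) = 1 := by
    intro k hk l hl hne
    obtain ⟨h1, h2⟩ := hdv a k hk
    obtain ⟨h3, h4⟩ := hdv b l hl
    have l1 := Nat.le_of_dvd pa h1
    have l2 := Nat.le_of_dvd pb h3
    exact ih (k + l) (by omega) k l rfl (h1.trans ha) (h3.trans hb)
      (fun hh => h2 (Nat.dvd_gcd h1 (hh.trans h3))) (fun hh => h4 (Nat.dvd_gcd (hh.trans h1) h3))
  have ma : a ∈ a.divisors \ g.divisors := by
    simp only [Finset.mem_sdiff, Nat.mem_divisors]
    exact ⟨⟨dvd_rfl, by omega⟩, fun hh => hab (hh.1.trans hgb)⟩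
  have mb : b ∈ b.divisors \ g.divisors := by
    simp only [Finset.mem_sdiff, Nat.mem_divisors]
    exact ⟨⟨dvd_rfl, by omega⟩, fun hh => hba (hh.1.trans hga)⟩
  rw [Finset.prod_eq_single_of_mem a ma (fun k hk hka =>
    Finset.prod_eq_one (fun l hl => one k hk l hl (fun hh => hka hh.1))),
    Finset.prod_eq_single_of_mem b mb (fun l hl hlb => one a ma l hl (fun hh => hlb hh.2))] at hu
  exact hu

end Dyn

lemma PolyF.line {p : ℂ × ℂ → ℂ} (hp : PolyF p) (v : ℂ) :
    ∃ q : Polynomial ℂ, ∀ w, q.eval w = p (v, v * w) := by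
  obtain ⟨P, rfl⟩ := hp
  refine ⟨MvPolynomial.aeval ![(Polynomial.C v : Polynomial ℂ), Polynomial.C v * Polynomial.X] P, ?_⟩
  intro w
  rw [ev, ← Polynomial.coe_evalRingHom, MvPolynomial.map_aeval]
  simp only [MvPolynomial.eval]
  congr 1
  ext i
  · simp
  · fin_cases i <;> simp

/-- a form vanishing near a point of a line vanishes identically -/
lemma Form.frequently {p e} (hp : Form p e) (h0 : ∃ Z, p Z ≠ 0) {v : ℂ} (hv : v ≠ 0) (z : ℂ) :
    ∃ᶠ w in nhds z, p (v, v * w) ≠ 0 := by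
  intro hev
  simp only [not_not] at hev
  obtain ⟨q, hq⟩ := hp.1.line v
  have hq0 : q = 0 := by
    apply Polynomial.eq_zero_of_infinite_isRoot
    refine Set.Infinite.mono (s := {w | p (v, v * w) = 0}) (fun w hw => ?_) ?_
    · show q.eval w = 0
      rw [hq]; exact hw
    · exact infinite_of_mem_nhds z hev
  have hz : ∀ w, p (v, v * w) = 0 := fun w => by rw [← hq, hq0]; simp
  obtain ⟨Z, hZ⟩ := h0
  apply hZ
  refine PolyF.cancel PolyF.fst hp.1 (PolyF.const 0) ⟨(1, 0), by simp⟩ (fun Z => ?_) Z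
  by_cases h1 : Z.1 = 0
  · rw [h1]; ring
  · have : Z = (Z.1 / v) • ((v, v * (Z.2 / Z.1)) : ℂ × ℂ) := by
      ext <;> simp <;> field_simp
    have h2 := hp.2 (Z.1 / v) (div_ne_zero h1 hv) (v, v * (Z.2 / Z.1))
    rw [← this, hz] at h2
    rw [h2]; ring

/-- affine map -/
noncomputable def aff (G : ℂ × ℂ → ℂ × ℂ) (w : ℂ) : ℂ := (G (1, w)).2 / (G (1, w)).1

lemma IsH.aff_smul {G D} (hG : IsH G D) {Z : ℂ × ℂ} (hZ : Z.1 ≠ 0) :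
    aff G (Z.2 / Z.1) = (G Z).2 / (G Z).1 := by
  have e : Z = Z.1 • ((1, Z.2 / Z.1) : ℂ × ℂ) := by
    ext <;> simp; field_simp
  have h1 := hG.1.2 Z.1 hZ (1, Z.2 / Z.1)
  have h2 := hG.2.2 Z.1 hZ (1, Z.2 / Z.1)
  rw [← e] at h1 h2
  simp only at h1 h2
  rw [h1, h2, aff]
  rw [mul_div_mul_left _ _ (pow_ne_zero _ hZ)]

lemma IsH.aff_iterate {G D} (hG : IsH G D) (m : ℕ) {Z : ℂ × ℂ} 
    (h : ∀ i < m, (G^[i] Z).1 ≠ 0) : (aff G)^[m] (Z.2 / Z.1) = (G^[m] Z).2 / (G^[m] Z).1 := by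
  induction m with
  | zero => simp
  | succ m ih =>
    rw [Function.iterate_succ_apply', ih (fun i hi => h i (by omega)), hG.aff_smul (h m (by omega)),
      Function.iterate_succ_apply']

lemma IsH.aff_strict {G D} (hG : IsH G D) {z : ℂ} (hz : (G (1, z)).1 ≠ 0) :
    HasStrictDerivAt (aff G) (deriv (aff G) z) z := by
  obtain ⟨q1, h1⟩ := hG.1.1.line 1
  obtain ⟨q2, h2⟩ := hG.2.1.line 1
  simp only [one_mul] at h1 h2
  have : aff G = fun w => q2.eval w / q1.eval w := by
    funext w; rw [h1, h2, aff]
  have hs := (q2.hasStrictDerivAt z).fun_div (q1.hasStrictDerivAt z) (by rw [h1]; exact hz)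
  rw [← this] at hs
  rw [hs.hasDerivAt.deriv]; exact hs

lemma lim_quot {G D} (hG : IsH G D) (hD : 1 ≤ D) {P : ℂ × ℂ} (hP1 : P.1 ≠ 0) (hP : G P = P) {Q}
    (hQ : PolyF Q) (r K : ℕ) (hQe : ∀ Z, wedge (G^[r * K] Z) Z = wedge (G^[r] Z) Z * Q Z)
    (h01 : wedge (G^[r] (0, 1)) (0, 1) ≠ 0) :
    Q P = ∑ i ∈ range K, deriv (aff G) (P.2 / P.1) ^ (r * i) := by
  set v := P.1 with hv
  set z := P.2 / v with hz
  set f := aff G with hf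
  set lm := deriv f z with hlm
  have hPe : ((v, v * z) : ℂ × ℂ) = P := by
    ext
    · rfl
    · show v * z = P.2
      rw [hz]; field_simp
  have hfz : f z = z := by
    rw [hf, hz, hG.aff_smul hP1, hP]
  have hPit : ∀ m, G^[m] P = P := fun m => Function.iterate_fixed hP m
  have h1z : (G (1, z)).1 ≠ 0 := by
    intro h0
    have h1 := hG.1.2 v hP1 (1, z)
    simp only [Prod.smul_mk, smul_eq_mul, mul_one, hPe, hP, h0, mul_zero] at h1
    exact hP1 h1
  have hst : HasStrictDerivAt f lm z := hG.aff_strict h1z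
  have cont : Continuous (fun w : ℂ => ((v, v * w) : ℂ × ℂ)) := by fun_prop
  have tP : ∀ {p : ℂ × ℂ → ℂ}, PolyF p → Tendsto (fun w : ℂ => p (v, v * w)) (nhds z) (nhds (p P)) := by
    intro p hp
    have := (hp.continuous.comp cont).tendsto z
    simpa [Function.comp_def, hPe] using this
  have h1m : ∀ m, Tendsto (fun w : ℂ => (G^[m] (v, v * w)).1) (nhds z) (nhds v) := by
    intro m
    have := tP (hG.iterate m).1.1
    rwa [hPit] at this
  have hnz : ∀ m, ∀ᶠ w in nhds z, (G^[m] (v, v * w)).1 ≠ 0 := fun m =>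
    (h1m m).eventually_ne hP1
  have hit : ∀ m, ∀ᶠ w in nhds z, wedge (G^[m] (v, v * w)) (v, v * w) =
      (G^[m] (v, v * w)).1 * v * (w - f^[m] w) := by
    intro m
    have : ∀ᶠ w in nhds z, ∀ i ∈ Set.Iic m, (G^[i] (v, v * w)).1 ≠ 0 :=
      (eventually_all_finite (Set.finite_Iic m)).2 (fun i _ => hnz i)
    filter_upwards [this] with w hw
    have h1 := hG.aff_iterate m (Z := (v, v * w)) (fun i hi => hw i (by simp; omega))
    have h2 : v * w / v = w := by field_simp
    have hm := hw m (by simp)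
    simp only [h2] at h1
    rw [hf, h1, wedge]
    field_simp
  set g := f^[r] with hgdef
  have hgz : g z = z := Function.iterate_fixed hfz r
  have hgs : HasStrictDerivAt g (lm ^ r) z := hst.iterate z hfz r
  have hgt : Tendsto g (nhds z) (nhds z) := by
    have := hgs.hasDerivAt.continuousAt.tendsto; rwa [hgz] at this
  have htt : Tendsto (fun w => (w, g w)) (nhds z) (nhds (z, z)) :=
    tendsto_id.prodMk_nhds hgt
  set S := ∑ i ∈ range K, lm ^ (r * i) with hS
  have lo : (fun w => (w - g^[K] w) - S * (w - g w)) =o[nhds z] (fun w => w - g w) := by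
    have := Asymptotics.IsLittleO.fun_sum (s := range K)
      (A := fun i w => g^[i] w - g^[i] (g w) - (lm ^ r) ^ i * (w - g w)) (l := nhds z)
      (g' := fun w => w - g w) (fun i _ => by
        have h1 := (hgs.iterate z hgz i).hasStrictFDerivAt.isLittleO.comp_tendsto htt
        simpa [Function.comp_def, mul_comm] using h1)
    refine this.congr_left (fun w => ?_)
    rw [Finset.sum_sub_distrib, ← Finset.sum_mul]
    simp only [← Function.iterate_succ_apply]
    rw [Finset.sum_range_sub' (fun i => g^[i] w)]
    simp [hS, pow_mul]
  have lo2 : (fun w => (G^[r * K] (v, v * w)).1 * ((w - g^[K] w) - S * (w - g w))) =o[nhds z]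
      (fun w => w - g w) := by
    have := ((h1m (r * K)).isBigO_one ℂ).mul_isLittleO lo
    simpa using this
  set E : ℂ → ℂ := fun w => (G^[r] (v, v * w)).1 * Q (v, v * w) - (G^[r * K] (v, v * w)).1 * S with hE
  have hEl : Tendsto E (nhds z) (nhds (v * Q P - v * S)) :=
    ((h1m r).mul (tP hQ)).sub ((h1m (r * K)).mul_const S)
  have lo3 : (fun w => E w * (w - g w)) =o[nhds z] (fun w => w - g w) := by
    refine lo2.congr' ?_ (EventuallyEq.rfl)
    filter_upwards [hit r, hit (r * K)] with w e1 e2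
    have e3 := hQe (v, v * w)
    rw [e1, e2] at e3
    rw [Function.iterate_mul f] at e3
    apply mul_left_cancel₀ hP1
    simp only [hE]
    linear_combination e3
  have hfreq : ∃ᶠ w in nhds z, w - g w ≠ 0 := by
    refine ((hG.iterate r).fix_form.frequently ⟨_, h01⟩ hP1 z).and_eventually (hit r) |>.mono ?_
    rintro w ⟨h1, h2⟩ h3
    apply h1
    show wedge (G^[r] (v, v * w)) (v, v * w) = 0
    rw [h2, h3, mul_zero]
  by_contra hne
  have hL : v * Q P - v * S ≠ 0 := by
    rw [← mul_sub]; exact mul_ne_zero hP1 (sub_ne_zero.2 hne)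
  set L := v * Q P - v * S
  have hLp : 0 < ‖L‖ := norm_pos_iff.2 hL
  have ev1 : ∀ᶠ w in nhds z, ‖L‖ / 2 < ‖E w‖ := hEl.norm.eventually_const_lt (by linarith)
  have ev2 := lo3.def (show (0:ℝ) < ‖L‖ / 2 by linarith)
  obtain ⟨w, hw, h1, h2⟩ := (hfreq.and_eventually (ev1.and ev2)).exists
  rw [norm_mul] at h2
  have := norm_pos_iff.2 hw
  nlinarith

lemma cyclo_quot {r M : ℕ} (hM : 0 < M) (hr : r ∣ M) (x : ℂ) :
    ∏ k ∈ M.divisors \ r.divisors, (Polynomial.cyclotomic k ℂ).eval x =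
      ∑ i ∈ range (M / r), x ^ (r * i) := by
  have hr0 : 0 < r := Nat.pos_of_dvd_of_pos hr hM
  have key : ∏ k ∈ M.divisors \ r.divisors, Polynomial.cyclotomic k ℂ =
      ∑ i ∈ range (M / r), (Polynomial.X : Polynomial ℂ) ^ (r * i) := by
    apply mul_right_cancel₀ (Polynomial.X_pow_sub_C_ne_zero hr0 (1 : ℂ))
    rw [Polynomial.C_1]
    nth_rewrite 1 [← Polynomial.prod_cyclotomic_eq_X_pow_sub_one hr0]
    rw [Finset.prod_sdiff (Nat.divisors_subset_of_dvd (by omega) hr),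
      Polynomial.prod_cyclotomic_eq_X_pow_sub_one hM]
    simp only [pow_mul]
    rw [geom_sum_mul, ← pow_mul, Nat.mul_div_cancel' hr]
  have := congrArg (Polynomial.eval x) key
  simpa [Polynomial.eval_prod, Polynomial.eval_finsetSum] using this

lemma cyclo_val {G D} (hG : IsH G D) (hD : 1 ≤ D) {P : ℂ × ℂ} (hP1 : P.1 ≠ 0) (hP : G P = P)
    {N : ℕ} (hN : 0 < N) {Ψ : ℕ → ℂ × ℂ → ℂ} (hΨ : ∀ s : Finset ℕ, PolyF (fun Z => ∏ k ∈ s, Ψ k Z))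
    (hdyn : ∀ M, M ∣ N → ∀ Z, wedge (G^[M] Z) Z = ∏ k ∈ M.divisors, Ψ k Z)
    (h01 : ∀ M, M ∣ N → wedge (G^[M] (0, 1)) (0, 1) ≠ 0) :
    ∀ M, M ∣ N → 1 < M →
      Ψ M P = (Polynomial.cyclotomic M ℂ).eval (deriv (aff G) (P.2 / P.1)) := by
  intro M
  set x := deriv (aff G) (P.2 / P.1) with hx
  induction M using Nat.strong_induction_on with
  | _ M ih =>
  intro hMN hM1
  have step : ∀ r, r ∣ M → r < M → (∀ k ∈ M.divisors \ r.divisors, k ≠ M →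
      (Polynomial.cyclotomic k ℂ).eval x ≠ 0) → Ψ M P = (Polynomial.cyclotomic M ℂ).eval x := by
    intro r hr hrM hne
    have hr0 : 0 < r := Nat.pos_of_dvd_of_pos hr (by omega)
    have hq := lim_quot hG hD hP1 hP (hΨ (M.divisors \ r.divisors)) r (M / r) (fun Z => by
      rw [Nat.mul_div_cancel' hr, hdyn M hMN, hdyn r (hr.trans hMN), mul_comm, Finset.prod_sdiff]
      exact Nat.divisors_subset_of_dvd (by omega) hr) (h01 r (hr.trans hMN))
    rw [← hx, ← cyclo_quot (by omega) hr] at hq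
    have hmem : M ∈ M.divisors \ r.divisors := by
      simp only [Finset.mem_sdiff, Nat.mem_divisors]
      exact ⟨⟨dvd_rfl, by omega⟩, fun h => by have := Nat.le_of_dvd hr0 h.1; omega⟩
    rw [← Finset.mul_prod_erase _ _ hmem, ← Finset.mul_prod_erase _ _ hmem] at hq
    have hsame : ∏ k ∈ (M.divisors \ r.divisors).erase M, Ψ k P =
        ∏ k ∈ (M.divisors \ r.divisors).erase M, (Polynomial.cyclotomic k ℂ).eval x := by
      refine Finset.prod_congr rfl (fun k hk => ?_)
      simp only [Finset.mem_erase, Finset.mem_sdiff, Nat.mem_divisors] at hk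
      have hle := Nat.le_of_dvd (by omega) hk.2.1.1
      refine ih k (by omega) (hk.2.1.1.trans hMN) ?_
      have h0 : k ≠ 0 := by rintro rfl; simp at hk <;> omega
      have h1 : k ≠ 1 := by rintro rfl; simp at hk <;> omega
      omega
    rw [hsame] at hq
    refine mul_right_cancel₀ (Finset.prod_ne_zero_iff.2 (fun k hk => ?_)) hq
    rw [Finset.mem_erase] at hk
    exact hne k hk.2 hk.1
  by_cases hex : ∃ r, r ∣ M ∧ r < M ∧ (Polynomial.cyclotomic r ℂ).eval x = 0
  · obtain ⟨r, hr, hrM, h0⟩ := hex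
    have hr0 : 0 < r := Nat.pos_of_dvd_of_pos hr (by omega)
    refine step r hr hrM (fun k hk hkM hk0 => ?_)
    simp only [Finset.mem_sdiff, Nat.mem_divisors] at hk
    have hkp : 0 < k := Nat.pos_of_dvd_of_pos hk.1.1 (by omega)
    have : NeZero (r : ℂ) := ⟨by exact_mod_cast hr0.ne'⟩
    have : NeZero (k : ℂ) := ⟨by exact_mod_cast hkp.ne'⟩
    have p1 := Polynomial.isRoot_cyclotomic_iff.1 h0
    have p2 := Polynomial.isRoot_cyclotomic_iff.1 hk0
    have : k = r := p2.unique p1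
    exact hk.2 ⟨this.dvd, by omega⟩
  · push Not at hex
    refine step 1 (one_dvd _) hM1 (fun k hk hkM => ?_)
    simp only [Finset.mem_sdiff, Nat.mem_divisors] at hk
    have hle := Nat.le_of_dvd (by omega) hk.1.1
    exact hex k hk.1.1 (by omega)

lemma dvd_iff_aux {k l N : ℕ} (hk : 0 < k) : k ∣ l * N ↔ k / k.gcd l ∣ N := by
  set g := k.gcd l with hg
  have hg0 : 0 < g := Nat.gcd_pos_of_pos_left _ hk
  obtain ⟨k', hk'⟩ := Nat.gcd_dvd_left k l
  obtain ⟨l', hl'⟩ := Nat.gcd_dvd_right k l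
  rw [← hg] at hk' hl'
  have hc : Nat.Coprime (k / g) (l / g) := Nat.coprime_div_gcd_div_gcd hg0
  have e1 : k / g = k' := by rw [hk']; exact Nat.mul_div_cancel_left _ hg0
  have e2 : l / g = l' := by rw [hl']; exact Nat.mul_div_cancel_left _ hg0
  rw [e1, e2] at hc
  rw [e1, hk', hl', mul_assoc, Nat.mul_dvd_mul_iff_left hg0]
  exact ⟨fun h => hc.dvd_of_dvd_mul_left h, fun h => h.mul_left _⟩

namespace Dyn
variable {F : ℂ × ℂ → ℂ × ℂ} {d n : ℕ} {T : ℕ → Multiset (ℂ × ℂ)} {Φ : ℕ → ℂ × ℂ → ℂ}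

lemma fst_ne (h : Dyn F d n T Φ) {k} (hk : k ∣ n) : ∀ t ∈ T k, t.1 ≠ 0 := by
  intro t ht h0
  apply h.h01 k hk
  rw [h.fac k, Multiset.prod_eq_zero_iff]
  exact Multiset.mem_map.2 ⟨t, ht, by simp [wedge, h0]⟩

lemma cyclo (h : Dyn F d n T Φ) {l : ℕ} (hl : l ∣ n) (hln : l < n) :
    np (T l) (Φ n) = np (T l) (fun t =>
      (Polynomial.cyclotomic (n / l) ℂ).eval (deriv (aff (F^[l])) (t.2 / t.1))) := by
  have pl := h.pos hl
  set N := n / l with hN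
  have hlN : l * N = n := Nat.mul_div_cancel' hl
  have hN1 : 1 < N := by
    by_contra hcon
    have : l * N ≤ l * 1 := Nat.mul_le_mul_left _ (by omega)
    omega
  set S : ℕ → Finset ℕ := fun M => n.divisors.filter (fun k => k / k.gcd l = M) with hS
  set Ψ : ℕ → ℂ × ℂ → ℂ := fun M Z => ∏ k ∈ S M, Φ k Z with hΨ
  have hΨf : ∀ M, Fac (Ψ M) (∑ k ∈ S M, T k) := fun M => Fac.prod h.fac _
  have hG := h.hH.iterate l
  have dl := h.deg hl
  have hdyn : ∀ M, M ∣ N → ∀ Z, wedge ((F^[l])^[M] Z) Z = ∏ k ∈ M.divisors, Ψ k Z := by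
    intro M hM Z
    have hM0 : 0 < M := Nat.pos_of_dvd_of_pos hM (by omega)
    have hlM : l * M ∣ n := by rw [← hlN]; exact Nat.mul_dvd_mul_left l hM
    rw [← Function.iterate_mul, h.dyn _ hlM]
    rw [← Finset.prod_fiberwise_of_maps_to (s := (l * M).divisors) (t := M.divisors)
      (g := fun k => k / k.gcd l)]
    · refine Finset.prod_congr rfl (fun M' hM' => ?_)
      refine Finset.prod_congr ?_ (fun _ _ => rfl)
      ext k
      simp only [hS, Finset.mem_filter, Nat.mem_divisors]
      constructor
      · rintro ⟨⟨h1, h2⟩, h3⟩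
        exact ⟨⟨h1.trans hlM, h.hn⟩, h3⟩
      · rintro ⟨⟨h1, h2⟩, h3⟩
        refine ⟨⟨(dvd_iff_aux (h.pos h1)).2 ?_, by positivity⟩, h3⟩
        rw [h3]; exact Nat.dvd_of_mem_divisors hM'
    · intro k hk
      have hk := Nat.dvd_of_mem_divisors hk
      exact Nat.mem_divisors.2 ⟨(dvd_iff_aux (h.pos (hk.trans hlM))).1 hk, by omega⟩
  have h01 : ∀ M, M ∣ N → wedge ((F^[l])^[M] (0, 1)) (0, 1) ≠ 0 := by
    intro M hM
    rw [← Function.iterate_mul]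
    exact h.wedge01 (by rw [← hlN]; exact Nat.mul_dvd_mul_left l hM)
  -- only `n` contributes to `Ψ N`
  have h1 : np (T l) (Ψ N) = np (T l) (Φ n) := by
    rw [hΨ, np_prod]
    refine Finset.prod_eq_single_of_mem n ?_ ?_
    · simp only [hS, Finset.mem_filter, Nat.mem_divisors]
      refine ⟨⟨dvd_rfl, h.hn⟩, ?_⟩
      rw [Nat.gcd_eq_right hl]
    · intro k hk hkn
      simp only [hS, Finset.mem_filter, Nat.mem_divisors] at hk
      refine h.incomp _ l k rfl hl hk.1.1 (fun hh => ?_) (fun hh => ?_)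
      · have h3 := hk.2
        rw [Nat.gcd_eq_right hh] at h3
        apply hkn
        rw [← hlN, ← h3, Nat.mul_div_cancel' hh]
      · have h3 := hk.2
        rw [Nat.gcd_eq_left hh, Nat.div_self (h.pos hk.1.1)] at h3
        omega
  rw [← h1]
  obtain ⟨c, hc⟩ := exists_scale (F^[l])
  have hall : ∀ t ∈ T l, F^[l] t = c t • t := fun t ht =>
    hc t (h.ne_zero hl t ht) (h.root dvd_rfl hl t ht)
  have hnc := h.scale l hl c hall
  have hc0 := np_ne_zero (by rw [hnc]; exact one_ne_zero : np (T l) c ≠ 0)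
  have hs : ∀ t : ℂ × ℂ, ∃ s : ℂ, s ^ (d ^ l - 1) = (c t)⁻¹ := fun t =>
    IsAlgClosed.exists_pow_nat_eq _ (by omega)
  choose s hs using hs
  have hs1 : np (T l) s = 1 := by
    have : np (T l) (fun t => s t ^ (d ^ l - 1) * c t) = np (T l) (fun _ => 1) := 
      np_congr (fun t ht => by rw [hs, inv_mul_cancel₀ (hc0 t ht)])
    rw [np_mul, np_pow, hnc, np_const, norm_one, one_pow, mul_one] at this
    refine (pow_eq_one_iff_of_nonneg ?_ (by omega)).1 this
    unfold np
    exact Multiset.prod_nonneg (by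
      intro a ha; obtain ⟨t, -, rfl⟩ := Multiset.mem_map.1 ha; exact norm_nonneg _)
  have hmain : np (T l) (fun t => (Polynomial.cyclotomic N ℂ).eval (deriv (aff (F^[l])) (t.2 / t.1))) =
      np (T l) (fun t => s t ^ (Multiset.card (∑ k ∈ S N, T k)) * Ψ N t) := by
    refine np_congr (fun t ht => ?_)
    have hs0 : s t ≠ 0 := by
      intro h0
      have := hs t
      rw [h0, zero_pow (by omega)] at this
      exact inv_ne_zero (hc0 t ht) this.symm
    have hP : F^[l] (s t • t) = s t • t := by
      rw [hG.smul (by omega), hall t ht, smul_smul]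
      congr 1
      have : d ^ l = (d ^ l - 1) + 1 := by omega
      rw [this, pow_succ, hs]
      field_simp [hc0 t ht]
    have := cyclo_val hG (by omega) (P := s t • t)
      (by simpa using ⟨hs0, h.fst_ne hl t ht⟩) hP (by omega : 0 < N)
      (fun s => (Fac.prod hΨf s).polyF) hdyn h01 N dvd_rfl hN1
    rw [(hΨf N).smul] at this
    have e : (s t • t).2 / (s t • t).1 = t.2 / t.1 := by
      simp only [Prod.smul_fst, Prod.smul_snd, smul_eq_mul]
      rw [mul_div_mul_left _ _ hs0]
    rw [this, e]
  rw [hmain, np_mul, np_pow, hs1, one_pow, one_mul]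

end Dyn

lemma local_mult {G D} (hG : IsH G D) {t : ℂ × ℂ} (ht : t.1 ≠ 0) {c : ℂ} (hc0 : c ≠ 0)
    (hc : G t = c • t) {q} (hq : PolyF q) (hqe : ∀ Z, wedge (G Z) Z = wedge Z t * q Z) :
    q t = c * (deriv (aff G) (t.2 / t.1) - 1) := by
  set v := t.1 with hv
  set z := t.2 / v with hz
  set x := deriv (aff G) z with hx
  have hte : ((v, v * z) : ℂ × ℂ) = t := by
    ext
    · rfl
    · show v * z = t.2
      rw [hz]; field_simp
  have hfz : aff G z = z := by
    rw [hz, hG.aff_smul ht, hc]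
    simp only [Prod.smul_fst, Prod.smul_snd, smul_eq_mul]
    rw [mul_div_mul_left _ _ hc0]
  have hG1 : (G (v, v * z)).1 = c * v := by rw [hte, hc]; simp [hv]
  have h1z : (G (1, z)).1 ≠ 0 := by
    intro h0
    have h1 := hG.1.2 v ht (1, z)
    simp only [Prod.smul_mk, smul_eq_mul, mul_one, hG1, h0, mul_zero] at h1
    exact mul_ne_zero hc0 ht h1
  have hst := (hG.aff_strict h1z).hasDerivAt
  obtain ⟨Q1, hQ1⟩ := hG.1.1.line v
  obtain ⟨Q2, hQ2⟩ := hq.line v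
  have d1 := ((Q1.hasDerivAt z).mul_const v).fun_mul ((hasDerivAt_id' z).fun_sub hst)
  have d2 := (((hasDerivAt_id' z).const_sub z).const_mul (v * v)).fun_mul (Q2.hasDerivAt z)
  have hev : (fun w => Q1.eval w * v * (w - aff G w)) =ᶠ[nhds z]
      (fun w => v * v * (z - w) * Q2.eval w) := by
    have : ∀ᶠ w in nhds z, Q1.eval w ≠ 0 := by
      refine Q1.continuous.continuousAt.eventually_ne ?_
      rw [hQ1, hG1]; exact mul_ne_zero hc0 ht
    filter_upwards [this] with w hw
    have h1 := hqe (v, v * w)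
    have h2 := hG.aff_smul (Z := (v, v * w)) ht
    have h3 : v * w / v = w := by field_simp
    simp only [h3] at h2
    rw [hQ1] at hw
    rw [h2, hQ1, hQ2]
    rw [wedge, wedge, ← hv] at h1
    have h4 : t.2 = v * z := by rw [hz]; field_simp
    simp only [h4] at h1
    have h5 : (G (v, v * w)).1 * v * (w - (G (v, v * w)).2 / (G (v, v * w)).1) =
        (G (v, v * w)).1 * v * w - (G (v, v * w)).2 * v := by
      generalize (G (v, v * w)).1 = a at *
      field_simp
    rw [h5]
    linear_combination h1
  have := d1.unique (d2.congr_of_eventuallyEq hev)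
  rw [hQ1, hQ2, hfz, hte] at this
  simp only [hc, Prod.smul_fst, smul_eq_mul, ← hv, ← hx] at this
  apply mul_left_cancel₀ (mul_ne_zero ht ht)
  linear_combination this

lemma fac_range (s : Finset ℕ) (u : ℕ → ℂ × ℂ) :
    Fac (fun Z => ∏ j ∈ s, wedge Z (u j)) (s.val.map u) := by
  intro Z
  simp

lemma np_range (s : Finset ℕ) (u : ℕ → ℂ × ℂ) (f) :
    np (s.val.map u) f = ∏ j ∈ s, ‖f (u j)‖ := by
  simp [np]

lemma main_aux {F : ℂ × ℂ → ℂ × ℂ} {d n : ℕ} (s : ℕ → Finset ℕ) (Zp : ℕ → ℕ → ℂ × ℂ)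
    (h : Dyn F d n (fun k => (s k).val.map (Zp k)) (fun k Z => ∏ j ∈ s k, wedge Z (Zp k j))) :
    (∏ i ∈ s n, ∏ j ∈ (s n).erase i, ‖wedge (Zp n i) (Zp n j)‖) *
      ∏ l ∈ n.properDivisors, ∏ j ∈ s l, ‖Polynomial.eval
        (deriv (aff (F^[l])) ((Zp l j).2 / (Zp l j).1)) (Polynomial.cyclotomic (n / l) ℂ)‖ =
      ∏ j ∈ s n, ‖deriv (aff (F^[n])) ((Zp n j).2 / (Zp n j).1) - 1‖ := by
  have hmem : ∀ j ∈ s n, Zp n j ∈ (s n).val.map (Zp n) := fun j hj => Multiset.mem_map_of_mem _ hj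
  obtain ⟨c, hc⟩ := exists_scale (F^[n])
  have hall : ∀ t ∈ (s n).val.map (Zp n), F^[n] t = c t • t := fun t ht =>
    hc t (h.ne_zero dvd_rfl t ht) (h.root dvd_rfl dvd_rfl t ht)
  have hnc : np ((s n).val.map (Zp n)) c = 1 := h.scale n dvd_rfl c hall
  have hc0 := np_ne_zero (by rw [hnc]; exact one_ne_zero : np ((s n).val.map (Zp n)) c ≠ 0)
  have hcyc : ∀ l ∈ n.properDivisors, ∏ j ∈ s l, ‖Polynomial.eval
        (deriv (aff (F^[l])) ((Zp l j).2 / (Zp l j).1)) (Polynomial.cyclotomic (n / l) ℂ)‖ =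
      ∏ i ∈ s n, ‖∏ j ∈ s l, wedge (Zp n i) (Zp l j)‖ := by
    intro l hl
    rw [Nat.mem_properDivisors] at hl
    have h1 := h.cyclo hl.1 hl.2
    rw [(h.fac l).recip (h.fac n)] at h1
    rw [np_range, np_range] at h1
    exact h1.symm
  rw [Finset.prod_congr rfl hcyc, Finset.prod_comm, ← Finset.prod_mul_distrib]
  rw [np_range] at hnc
  rw [← one_mul (∏ j ∈ s n, ‖_ - 1‖), ← hnc, ← Finset.prod_mul_distrib]
  refine Finset.prod_congr rfl (fun i hi => ?_)
  have hq : PolyF (fun Z => (∏ j ∈ (s n).erase i, wedge Z (Zp n j)) *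
      ∏ l ∈ n.properDivisors, ∏ j ∈ s l, wedge Z (Zp l j)) :=
    (fac_range ((s n).erase i) (Zp n)).polyF.mul (Fac.prod h.fac n.properDivisors).polyF
  have := local_mult (h.hH.iterate n) (h.fst_ne dvd_rfl _ (hmem i hi)) (hc0 _ (hmem i hi))
    (hall _ (hmem i hi)) hq (fun Z => by
      rw [h.dyn n dvd_rfl, ← Nat.cons_self_properDivisors h.hn, Finset.prod_cons,
        ← Finset.mul_prod_erase _ _ hi, mul_assoc])
  rw [← norm_mul, ← this, norm_mul, norm_prod, norm_prod]

/-- Assume `|Res F| = 1` and fix dynatomic data for `n`.  Then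
`∏_{i ≠ j} |Z^{(n)}_i ∧ Z^{(n)}_j| · ∏_{ℓ ∣ n, ℓ < n} ∏_j |C_{n/ℓ}(λ^{(ℓ)}_j)|
 = ∏_j |λ^{(n)}_j − 1|`, i.e.
`|D^{**}_n| = |Δ_{n,n}|^n ∏_{ℓ ∣ n, ℓ < n} |Δ_{n,ℓ}|^{n−ℓ}` in the normalization
`|Res F| = 1`. -/
theorem stmt14 (d : ℕ) (hd : 2 ≤ d) (F₀ F₁ : MvPolynomial (Fin 2) ℂ)
    (h₀ : F₀.IsHomogeneous d) (h₁ : F₁.IsHomogeneous d)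
    (hcz : ∀ Z : ℂ × ℂ, ev F₀ Z = 0 → ev F₁ Z = 0 → Z = 0)
    (A : Fin d → ℂ × ℂ) (hA : ∀ i, A i ≠ 0)
    (hfac : ∀ Z : ℂ × ℂ, ev F₀ Z = ∏ i, wedge Z (A i))
    (hres : ∏ i, ‖ev F₁ (A i)‖ = 1)
    (n : ℕ) (hn : 1 ≤ n)
    (Zp : ℕ → ℕ → ℂ × ℂ)
    (hfst : ∀ m ∈ n.divisors, ∀ j ∈ Finset.range (dyndeg d m).toNat, (Zp m j).1 ≠ 0)
    (hdyn : ∀ m ∈ n.divisors, ∀ Z : ℂ × ℂ,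
      wedge ((Fmap F₀ F₁)^[m] Z) Z =
        ∏ k ∈ m.divisors, ∏ j ∈ Finset.range (dyndeg d k).toNat, wedge Z (Zp k j))
    (hden : ∀ m ∈ n.divisors, ∀ j ∈ Finset.range (dyndeg d m).toNat,
      ((Fmap F₀ F₁)^[m] (1, zc Zp m j)).1 ≠ 0) :
    (∏ i ∈ Finset.range (dyndeg d n).toNat,
        ∏ j ∈ (Finset.range (dyndeg d n).toNat).erase i, ‖wedge (Zp n i) (Zp n j)‖) *
      ∏ ℓ ∈ n.properDivisors, ∏ j ∈ Finset.range (dyndeg d ℓ).toNat,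
        ‖Polynomial.eval (lam F₀ F₁ Zp ℓ j) (Polynomial.cyclotomic (n / ℓ) ℂ)‖ =
      ∏ j ∈ Finset.range (dyndeg d n).toNat, ‖lam F₀ F₁ Zp n j - 1‖ := by
  have hFH : IsH (Fmap F₀ F₁) d := by
    have hform : ∀ P : MvPolynomial (Fin 2) ℂ, P.IsHomogeneous d → Form (fun Z => ev P Z) d := by
      intro P hP
      refine ⟨⟨P, rfl⟩, fun c _ Z => ?_⟩
      simp only [ev, MvPolynomial.eval_eq', Fin.prod_univ_two]
      rw [Finset.mul_sum]
      refine Finset.sum_congr rfl (fun e he => ?_)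
      have h1 := hP (MvPolynomial.mem_support_iff.1 he)
      have h2 : e 0 + e 1 = d := by
        rw [← h1]
        simp [Finsupp.weight_apply, Finsupp.sum_fintype]
      rw [← h2]
      simp
      ring
    exact ⟨hform F₀ h₀, hform F₁ h₁⟩
  have hgood : Good (Fmap F₀ F₁) d := by
    refine good_base (by omega) hFH (fun Z hZ => ?_) (S := (Finset.univ : Finset (Fin d)).val.map A)
      (by simp) (fun Z => ?_) ?_
    · exact hcz Z (congrArg Prod.fst hZ) (congrArg Prod.snd hZ)
    · show ev F₀ Z = _
      rw [hfac, Multiset.map_map]; rfl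
    · unfold np
      rw [← hres, Multiset.map_map]; rfl
  exact main_aux (F := Fmap F₀ F₁) (d := d) (fun k => Finset.range (dyndeg d k).toNat) Zp
    { hH := hFH
      hg := hgood
      hd := hd
      hn := by omega
      fac := fun k => fac_range _ _
      dyn := fun m hm => hdyn m (Nat.mem_divisors.2 ⟨hm, by omega⟩)
      h01 := fun k hk => Finset.prod_ne_zero_iff.2 (fun j hj => by
        have := hfst k (Nat.mem_divisors.2 ⟨hk, by omega⟩) j hj
        simpa [wedge] using this) }
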